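/- arXiv:2009.06267 — 4 statements merged into one kernel-verified Lean document; each statement's English description precedes it below -/
import Mathlib

section
/- Let (φ_m)_{m≥1} be any sequence of real numbers with 0 < φ_{m+1} < φ_m for all m ≥ 1. Then the series S₁(z) := ∑_{m=1}^∞ (φ_m/m²) sin(mz) satisfies S₁(z) > 0 for every z ∈ (0, π). -/
open Real

lemma two_mul_sin_half_mul_sum_cos (n : ℕ) (x : ℝ) :
    2 * sin (x / 2) * ∑ k ∈ Finset.range n, cos (((k : ℝ) + 1) * x) =
      sin (n * x + x / 2) - sin (x / 2) := by
  induction n with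
  | zero => simp
  | succ n ih =>
    have h₁ : ((n + 1 : ℕ) : ℝ) * x + x / 2 = ((n : ℝ) + 1) * x + x / 2 := by push_cast; ring
    have h₂ : (n : ℝ) * x + x / 2 = ((n : ℝ) + 1) * x - x / 2 := by ring
    rw [Finset.sum_range_succ, mul_add, ih, h₁, h₂, sin_add, sin_sub]
    ring

lemma sin_mul_nonneg_of_sum_cos_eq_zero {n : ℕ} {x : ℝ} (hx : x ∈ Set.Ioo 0 π)
    (h : ∑ k ∈ Finset.range n, cos (((k : ℝ) + 1) * x) = 0) : 0 ≤ sin (n * x) := by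
  have hs : 0 < sin (x / 2) := sin_pos_of_pos_of_lt_pi (by linarith [hx.1]) (by linarith [hx.1, hx.2])
  have hc : 0 < cos (x / 2) := cos_pos_of_mem_Ioo ⟨by linarith [hx.1, hx.2], by linarith [hx.2]⟩
  have key := two_mul_sin_half_mul_sum_cos n x
  rw [h, mul_zero] at key
  have hA : sin (n * x + x / 2) = sin (x / 2) := by linarith
  have hsq : cos (n * x + x / 2) ^ 2 = cos (x / 2) ^ 2 := by
    rw [cos_sq', cos_sq', hA]
  have hle : cos (n * x + x / 2) ≤ cos (x / 2) := (le_abs_self _).trans (abs_le_of_sq_le_sq hsq.le hc.le)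
  have hn : sin (n * x) = sin (x / 2) * (cos (x / 2) - cos (n * x + x / 2)) := by
    conv_lhs => rw [show (n : ℝ) * x = n * x + x / 2 - x / 2 by ring, sin_sub, hA]
    ring
  rw [hn]
  exact mul_nonneg hs.le (sub_nonneg.2 hle)

/-- The Fejér–Jackson inequality, in its non-strict form. -/
lemma sum_sin_div_nonneg (n : ℕ) {x : ℝ} (hx : x ∈ Set.Icc 0 π) :
    0 ≤ ∑ k ∈ Finset.range n, sin (((k : ℝ) + 1) * x) / ((k : ℝ) + 1) := by
  induction n generalizing x with
  | zero => simp
  | succ n ih =>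
    set F : ℝ → ℝ := fun y ↦
      ∑ k ∈ Finset.range (n + 1), sin (((k : ℝ) + 1) * y) / ((k : ℝ) + 1) with hF
    have hderiv (y : ℝ) :
        HasDerivAt F (∑ k ∈ Finset.range (n + 1), cos (((k : ℝ) + 1) * y)) y := by
      refine HasDerivAt.fun_sum fun k _ ↦ ?_
      have hk : (k : ℝ) + 1 ≠ 0 := by positivity
      have h := ((hasDerivAt_id' y).const_mul ((k : ℝ) + 1)).sin.div_const ((k : ℝ) + 1)
      rwa [mul_one, mul_div_cancel_right₀ _ hk] at h
    have hcont : Continuous F := continuous_iff_continuousAt.2 fun y ↦ (hderiv y).continuousAt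
    obtain ⟨y, hy, hmin⟩ := isCompact_Icc.exists_isMinOn ⟨x, hx⟩ hcont.continuousOn
    refine le_trans ?_ (hmin hx)
    rcases hy.1.eq_or_lt with rfl | h0
    · simp [hF]
    rcases hy.2.eq_or_lt with rfl | hπ
    · refine (Finset.sum_eq_zero fun k _ ↦ ?_).ge
      have := sin_nat_mul_pi (k + 1)
      push_cast at this
      rw [this, zero_div]
    have hloc : IsLocalMin F y := hmin.isLocalMin (Icc_mem_nhds h0 hπ)
    have hsin := sin_mul_nonneg_of_sum_cos_eq_zero ⟨h0, hπ⟩ (hloc.hasDerivAt_eq_zero (hderiv y))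
    push_cast at hsin
    simp only [hF, Finset.sum_range_succ]
    exact add_nonneg (ih hy) (div_nonneg hsin (by positivity))

lemma le_sum_mul_of_antitone_of_sum_nonneg {a b : ℕ → ℝ} (ha : Antitone a)
    (hb : ∀ n, 0 ≤ ∑ k ∈ Finset.range n, b k) (n : ℕ) :
    (a 0 - a 1) * b 0 + a (n + 1) * ∑ k ∈ Finset.range (n + 2), b k ≤
      ∑ k ∈ Finset.range (n + 2), a k * b k := by
  induction n with
  | zero => simp [Finset.sum_range_succ]; linarith
  | succ n ih =>
    rw [Finset.sum_range_succ b, Finset.sum_range_succ (fun k ↦ a k * b k)]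
    have := mul_le_mul_of_nonneg_right (ha (Nat.le_succ (n + 1))) (hb (n + 2))
    simp only [Nat.succ_eq_add_one] at this
    linarith

theorem stmt0 (φ : ℕ → ℝ) (hφ : ∀ m : ℕ, 1 ≤ m → 0 < φ (m + 1) ∧ φ (m + 1) < φ m)
    (z : ℝ) (hz : z ∈ Set.Ioo 0 π) :
    0 < ∑' m : ℕ, φ (m + 1) / ((m : ℝ) + 1) ^ 2 * Real.sin (((m : ℝ) + 1) * z) := by
  have hanti : Antitone fun m ↦ φ (m + 1) :=
    antitone_nat_of_succ_le fun m ↦ (hφ (m + 1) (by lia)).2.le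
  have hpos (m : ℕ) : 0 < φ (m + 1) :=
    (hφ (m + 1) (by lia)).1.trans (hφ (m + 1) (by lia)).2
  set a : ℕ → ℝ := fun m ↦ φ (m + 1) / ((m : ℝ) + 1) with ha
  set b : ℕ → ℝ := fun m ↦ sin (((m : ℝ) + 1) * z) / ((m : ℝ) + 1) with hb
  have hterm (m : ℕ) : φ (m + 1) / ((m : ℝ) + 1) ^ 2 * sin (((m : ℝ) + 1) * z) = a m * b m := by
    simp only [ha, hb]
    field_simp
  have ha_anti : Antitone a := fun m n hmn ↦
    div_le_div₀ (hpos m).le (hanti hmn) (by positivity) (by gcongr)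
  have hb_nonneg (n : ℕ) : 0 ≤ ∑ k ∈ Finset.range n, b k :=
    sum_sin_div_nonneg n (Set.Ioo_subset_Icc_self hz)
  have hsum : Summable fun m ↦ a m * b m := by
    have hsq : Summable fun m : ℕ ↦ φ 1 * (1 / ((m + 1 : ℕ) : ℝ) ^ 2) :=
      ((summable_nat_add_iff 1).2 (summable_one_div_nat_pow.2 one_lt_two)).mul_left _
    refine hsq.of_norm_bounded fun m ↦ ?_
    rw [← hterm, norm_mul, norm_eq_abs, norm_eq_abs, abs_of_pos (div_pos (hpos m) (by positivity))]
    calc φ (m + 1) / ((m : ℝ) + 1) ^ 2 * |sin (((m : ℝ) + 1) * z)|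
        ≤ φ (m + 1) / ((m : ℝ) + 1) ^ 2 * 1 := by
          have := (hpos m).le
          gcongr
          exact abs_sin_le_one _
      _ ≤ φ 1 / ((m : ℝ) + 1) ^ 2 * 1 := by
          gcongr
          exact hanti (Nat.zero_le m)
      _ = φ 1 * (1 / ((m + 1 : ℕ) : ℝ) ^ 2) := by push_cast; ring
  have hfirst : 0 < (a 0 - a 1) * b 0 := by
    refine mul_pos (sub_pos.2 ?_) ?_
    · have h₁ := hpos 1
      have h₂ := (hφ 1 le_rfl).2
      norm_num [ha] at h₁ ⊢
      linarith
    · simpa [hb] using sin_pos_of_mem_Ioo hz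
  simp only [hterm]
  refine hfirst.trans_le
    (ge_of_tendsto' ((Filter.tendsto_add_atTop_iff_nat 2).2 hsum.hasSum.tendsto_sum_nat) fun n ↦ ?_)
  have hnonneg : 0 ≤ a (n + 1) := div_nonneg (hpos (n + 1)).le (by positivity)
  linarith [le_sum_mul_of_antitone_of_sum_nonneg ha_anti hb_nonneg n,
    mul_nonneg hnonneg (hb_nonneg (n + 2))]
end

section
/- Let N ≥ 3 be an integer. For every integer m with 3 ≤ m ≤ N and every real z ∈ (0, π/(N+1)), one has sin(mz)/m² − sin((m+1)z)/(m+1)² > sin(z) · (1/m − 1/(m+1))². -/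
open Real

theorem mul_cos_le_sin {u : ℝ} (h0 : 0 < u) (hπ : u < π) : u * cos u ≤ sin u := by
  rcases lt_or_ge u (π / 2) with h | h
  · have hc : 0 < cos u := cos_pos_of_mem_Ioo ⟨by linarith, h⟩
    have ht := Real.lt_tan h0 h
    rw [tan_eq_sin_div_cos, lt_div_iff₀ hc] at ht
    exact ht.le
  · have hc : cos u ≤ 0 := cos_nonpos_of_pi_div_two_le_of_le h (by linarith)
    exact (mul_nonpos_of_nonneg_of_nonpos h0.le hc).trans (sin_pos_of_pos_of_lt_pi h0 hπ).le

theorem sin_lt_sin_of_add_lt_pi {x y : ℝ} (hx : 0 < x) (hxy : x < y) (h : x + y < π) :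
    sin x < sin y := by
  have hs : 0 < sin ((y - x) / 2) := sin_pos_of_pos_of_lt_pi (by linarith) (by linarith)
  have hc : 0 < cos ((y + x) / 2) := cos_pos_of_mem_Ioo ⟨by linarith, by linarith⟩
  have := sin_sub_sin y x
  nlinarith [mul_pos hs hc]

theorem sin_lt_sq_mul_sin_sub_sq_mul_sin {a z : ℝ} (ha : 1 < a) (hz : 0 < z)
    (haz : (a + 1) * z < π) :
    sin z < (a + 1) ^ 2 * sin (a * z) - a ^ 2 * sin ((a + 1) * z) := by
  have hu : z < a * z := lt_mul_of_one_lt_left hz ha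
  have hsum : z + a * z < π := by linarith
  have hsu : 0 < sin (a * z) := sin_pos_of_pos_of_lt_pi (by linarith) (by linarith)
  have hsz : 0 < sin z := sin_pos_of_pos_of_lt_pi hz (by linarith)
  have hlt := sin_lt_sin_of_add_lt_pi hz hu hsum
  have hle : a * sin z * cos (a * z) ≤ sin (a * z) := by
    rcases le_total 0 (cos (a * z)) with hc | hc
    · refine le_trans ?_ (mul_cos_le_sin (hz.trans hu) (by linarith))
      have := sin_le hz.le
      gcongr
    · exact (mul_nonpos_of_nonneg_of_nonpos (by positivity) hc).trans hsu.le
  have hcz : 0 ≤ a ^ 2 * sin (a * z) * (1 - cos z) :=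
    mul_nonneg (by positivity) (by linarith [cos_le_one z])
  have ha' : 0 < a := by linarith
  have hle' := mul_le_mul_of_nonneg_left hle ha'.le
  have hpos := mul_pos ha' hsu
  rw [add_one_mul a z, sin_add]
  linarith

theorem stmt12 (N : ℕ) (hN : 3 ≤ N) (m : ℕ) (hm : 3 ≤ m) (hmN : m ≤ N) (z : ℝ)
    (hz : z ∈ Set.Ioo 0 (π / ((N : ℝ) + 1))) :
    Real.sin z * (1 / (m : ℝ) - 1 / ((m : ℝ) + 1)) ^ 2 <
      Real.sin ((m : ℝ) * z) / (m : ℝ) ^ 2 -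
        Real.sin (((m : ℝ) + 1) * z) / ((m : ℝ) + 1) ^ 2 := by
  obtain ⟨hz0, hzN⟩ := hz
  have hm' : (3 : ℝ) ≤ m := by exact_mod_cast hm
  have hmN' : (m : ℝ) ≤ N := by exact_mod_cast hmN
  have hmz : ((m : ℝ) + 1) * z < π := by
    rw [lt_div_iff₀ (by positivity)] at hzN
    nlinarith
  have key := sin_lt_sq_mul_sin_sub_sq_mul_sin (by linarith) hz0 hmz
  have hm0 : (m : ℝ) ≠ 0 := by positivity
  have hm1 : (m : ℝ) + 1 ≠ 0 := by positivity
  have hl : sin z * (1 / (m : ℝ) - 1 / ((m : ℝ) + 1)) ^ 2 =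
      sin z / ((m : ℝ) ^ 2 * ((m : ℝ) + 1) ^ 2) := by
    field_simp
    ring
  have hr : sin ((m : ℝ) * z) / (m : ℝ) ^ 2 - sin (((m : ℝ) + 1) * z) / ((m : ℝ) + 1) ^ 2 =
      (((m : ℝ) + 1) ^ 2 * sin (m * z) - (m : ℝ) ^ 2 * sin (((m : ℝ) + 1) * z)) /
        ((m : ℝ) ^ 2 * ((m : ℝ) + 1) ^ 2) := by
    field_simp
  rw [hl, hr]
  gcongr
end

section
/- Let ℓ > 0, Ω = (0,π)×(−ℓ,ℓ), 0 < α < β, t > 0, and let u : Ω → (0,∞) be a positive function. Then the polarization of the product p_u·u equals the product of the polarized objects: [p_u u]_H(x,y) = p_{u_H}(x,y) · u_H(x,y) for every (x,y) ∈ Ω. -/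
open Real

/-- Polarization of a function on `ℝ × ℝ` with respect to the half-plane `x ≤ π/2`,
reflecting across the line `x = π/2` (so `x ↦ π - x`). -/
noncomputable def polarization (v : ℝ × ℝ → ℝ) : ℝ × ℝ → ℝ := fun z =>
  if z.1 ≤ π / 2 then max (v z) (v (π - z.1, z.2))
  else min (v z) (v (π - z.1, z.2))

/-- The two-valued weight associated to a function `v`: it equals `α` where
`0 < v ≤ √t` and `β` elsewhere (in particular where `v > √t`). -/
noncomputable def weight (α β t : ℝ) (v : ℝ × ℝ → ℝ) : ℝ × ℝ → ℝ := fun z =>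
  if 0 < v z ∧ v z ≤ Real.sqrt t then α else β

theorem mul_ite_monotoneOn {α β s : ℝ} (hα : 0 < α) (hαβ : α < β) :
    MonotoneOn (fun r : ℝ => (if 0 < r ∧ r ≤ s then α else β) * r) (Set.Ioi 0) := by
  have hβ : 0 < β := hα.trans hαβ
  intro a (ha : 0 < a) b (hb : 0 < b) hab
  dsimp only
  split_ifs with h₁ h₂ h₂
  · gcongr
  · gcongr
  · exact absurd ⟨ha, hab.trans h₂.2⟩ h₁
  · gcongr

theorem stmt16 (ℓ α β t : ℝ) (hℓ : 0 < ℓ) (hα : 0 < α) (hαβ : α < β) (ht : 0 < t)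
    (u : ℝ × ℝ → ℝ)
    (hu : ∀ z ∈ Set.Ioo (0 : ℝ) π ×ˢ Set.Ioo (-ℓ) ℓ, 0 < u z) :
    ∀ z ∈ Set.Ioo (0 : ℝ) π ×ˢ Set.Ioo (-ℓ) ℓ,
      polarization (fun w => weight α β t u w * u w) z =
        weight α β t (polarization u) z * polarization u z := by
  intro z hz
  have hz' : (π - z.1, z.2) ∈ Set.Ioo (0 : ℝ) π ×ˢ Set.Ioo (-ℓ) ℓ :=
    ⟨⟨sub_pos.2 hz.1.2, sub_lt_self _ hz.1.1⟩, hz.2⟩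
  have hmono := mul_ite_monotoneOn (s := Real.sqrt t) hα hαβ
  by_cases h : z.1 ≤ π / 2
  · simpa only [polarization, weight, if_pos h] using
      (hmono.map_max (hu z hz) (hu _ hz')).symm
  · simpa only [polarization, weight, if_neg h] using
      (hmono.map_min (hu z hz) (hu _ hz')).symm
end

section
/- Let ℓ > 0, Ω = (0,π)×(−ℓ,ℓ), 0 < α < β, t > 0, and let u : Ω → (0,∞) be a positive function. Then: (i) if p_u(x,y)·u(x,y) = [p_u u]_H(x,y) for every (x,y) ∈ Ω, then u(x,y) = u_H(x,y) for every (x,y) ∈ Ω; (ii) if p_u(x̄,y)·u(x̄,y) = [p_u u]_H(x,y) for every (x,y) ∈ Ω, then u(x̄,y) = u_H(x,y) for every (x,y) ∈ Ω. -/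
open Real

/-- Multiplying a function by its weight preserves and reflects the order of its positive values. -/
theorem weight_mul_le_weight_mul_iff {α β t : ℝ} (hα : 0 < α) (hαβ : α < β)
    {u : ℝ × ℝ → ℝ} {z w : ℝ × ℝ} (hz : 0 < u z) (hw : 0 < u w) :
    weight α β t u z * u z ≤ weight α β t u w * u w ↔ u z ≤ u w := by
  have hβ : 0 < β := hα.trans hαβ
  have strict : ∀ {a b : ℝ × ℝ}, 0 < u a → u a < u b →
      weight α β t u a * u a < weight α β t u b * u b := by
    intro a b ha hab
    have hb : 0 < u b := ha.trans hab
    have hweight : weight α β t u a ≤ weight α β t u b := by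
      simp only [weight, ha, hb, true_and]
      split_ifs <;> linarith
    have hpos : 0 < weight α β t u b := by
      unfold weight
      split_ifs <;> assumption
    exact mul_lt_mul' hweight hab ha.le hpos
  refine ⟨fun h => not_lt.1 fun hlt => (strict hw hlt).not_ge h, fun h => ?_⟩
  rcases h.lt_or_eq with hlt | heq
  · exact (strict hz hlt).le
  · simp [weight, heq]

theorem stmt17 (ℓ α β t : ℝ) (hℓ : 0 < ℓ) (hα : 0 < α) (hαβ : α < β) (ht : 0 < t)
    (u : ℝ × ℝ → ℝ)
    (hu : ∀ z ∈ Set.Ioo (0 : ℝ) π ×ˢ Set.Ioo (-ℓ) ℓ, 0 < u z) :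
    ((∀ z ∈ Set.Ioo (0 : ℝ) π ×ˢ Set.Ioo (-ℓ) ℓ,
        weight α β t u z * u z = polarization (fun w => weight α β t u w * u w) z) →
      ∀ z ∈ Set.Ioo (0 : ℝ) π ×ˢ Set.Ioo (-ℓ) ℓ, u z = polarization u z) ∧
    ((∀ z ∈ Set.Ioo (0 : ℝ) π ×ˢ Set.Ioo (-ℓ) ℓ,
        weight α β t u (π - z.1, z.2) * u (π - z.1, z.2) =
          polarization (fun w => weight α β t u w * u w) z) →
      ∀ z ∈ Set.Ioo (0 : ℝ) π ×ˢ Set.Ioo (-ℓ) ℓ, u (π - z.1, z.2) = polarization u z) := by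
  have hrefl : ∀ z ∈ Set.Ioo (0 : ℝ) π ×ˢ Set.Ioo (-ℓ) ℓ, 0 < u (π - z.1, z.2) := by
    rintro z ⟨⟨h₁, h₂⟩, h₃⟩
    exact hu _ ⟨⟨by simpa using h₂, by simpa using h₁⟩, h₃⟩
  constructor <;> intro h z hz <;> specialize h z hz <;> unfold polarization at h ⊢ <;>
    split_ifs at h ⊢
  · rw [eq_comm, max_eq_left_iff] at h ⊢
    exact (weight_mul_le_weight_mul_iff hα hαβ (hrefl z hz) (hu z hz)).1 h
  · rw [eq_comm, min_eq_left_iff] at h ⊢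
    exact (weight_mul_le_weight_mul_iff hα hαβ (hu z hz) (hrefl z hz)).1 h
  · rw [eq_comm, max_eq_right_iff] at h ⊢
    exact (weight_mul_le_weight_mul_iff hα hαβ (hu z hz) (hrefl z hz)).1 h
  · rw [eq_comm, min_eq_right_iff] at h ⊢
    exact (weight_mul_le_weight_mul_iff hα hαβ (hrefl z hz) (hu z hz)).1 h
end
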